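/- Let (b, f, G) and (b̂, f̂, Ĝ) be two families of random coefficients with the same constant L, and let J and Ĵ be the corresponding conditional costs. Suppose δβ(ω,s) := sup_{x ∈ ℝ^d} |b(ω,s,x) − b̂(ω,s,x)|, δf(ω,s) := sup_{x ∈ ℝ^d} |f(ω,s,x) − f̂(ω,s,x)| and δG(ω) := sup_{x ∈ ℝ^d} |G(ω,x) − Ĝ(ω,x)| are measurable. Then for every (t,x) ∈ [0,T] × ℝ^d, P-almost surely |J(t,x) − Ĵ(t,x)| ≤ E[ δG + ∫_t^T ( δf(s) + L(T+1)e^{LT} δβ(s) ) ds | 𝒢 ] (the conditional approximation estimate underlying Lemma 4.2). -/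

import Mathlib

open MeasureTheory Set

noncomputable section

/-- The Euclidean state space `ℝ^d`. -/
abbrev E (d : ℕ) := EuclideanSpace ℝ (Fin d)

/-- `X` is a state trajectory for the (pathwise) drift `b` started at `(r, ξ)`. -/
def IsTraj (d : ℕ) (T : ℝ) (b : ℝ → E d → E d) (r : ℝ) (ξ : E d) (X : ℝ → E d) : Prop :=
  ContinuousOn X (Icc r T) ∧ ∀ t ∈ Icc r T, X t = ξ + ∫ s in r..t, b s (X s)

/-- Random coefficients `(b, f, G)` with constant `L`: jointly measurable, and for a.e.
`ω`, the pathwise bounds and Lipschitz conditions of assumption (A1) hold. -/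
def RandomCoeffs (Ω : Type*) [MeasurableSpace Ω] (P : Measure Ω) (d : ℕ) (T L : ℝ)
    (b : Ω → ℝ → E d → E d) (f : Ω → ℝ → E d → ℝ) (G : Ω → E d → ℝ) : Prop :=
  Measurable (fun p : Ω × ℝ × E d => b p.1 p.2.1 p.2.2) ∧
  Measurable (fun p : Ω × ℝ × E d => f p.1 p.2.1 p.2.2) ∧
  Measurable (fun p : Ω × E d => G p.1 p.2) ∧
  ∀ᵐ ω ∂P,
    (∀ᵐ t ∂(volume.restrict (Icc (0 : ℝ) T)),
      (∀ x : E d, ‖b ω t x‖ ≤ L) ∧ (∀ x y : E d, ‖b ω t x - b ω t y‖ ≤ L * ‖x - y‖) ∧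
      (∀ x : E d, |f ω t x| ≤ L) ∧ (∀ x y : E d, |f ω t x - f ω t y| ≤ L * ‖x - y‖)) ∧
    (∀ x : E d, |G ω x| ≤ L) ∧ (∀ x y : E d, |G ω x - G ω y| ≤ L * ‖x - y‖)

/-- Grönwall's inequality in integral form, for a constant forcing term. -/
theorem le_mul_exp_of_le_add_mul_integral {u : ℝ → ℝ} {a c D K : ℝ} (hac : a ≤ c)
    (hu : ContinuousOn u (Icc a c)) (hu0 : ∀ s ∈ Icc a c, 0 ≤ u s) (hD : 0 ≤ D) (hK : 0 ≤ K)
    (h : ∀ s ∈ Icc a c, u s ≤ D + K * ∫ r in a..s, u r) :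
    ∀ s ∈ Icc a c, u s ≤ D * Real.exp (K * (s - a)) := by
  set w : ℝ → ℝ := IccExtend hac ((Icc a c).domRestrict u) with hw
  have hwc : Continuous w := hu.domRestrict.Icc_extend'
  have hwu : ∀ s ∈ Icc a c, w s = u s := fun s hs => IccExtend_of_mem hac _ hs
  have hint : ∀ s ∈ Icc a c, ∫ r in a..s, u r = ∫ r in a..s, w r := by
    intro s hs
    refine intervalIntegral.integral_congr fun r hr => ?_
    rw [uIcc_of_le hs.1] at hr
    exact (hwu r ⟨hr.1, hr.2.trans hs.2⟩).symm
  have hderiv : ∀ s, HasDerivAt (fun s => D + K * ∫ r in a..s, w r) (K * w s) s := fun s =>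
    ((hwc.integral_hasStrictDerivAt a s).hasDerivAt.const_mul K).const_add D
  have hle : ∀ s ∈ Icc a c, w s ≤ D + K * ∫ r in a..s, w r := fun s hs => by
    rw [hwu s hs, ← hint s hs]; exact h s hs
  have hw0 : ∀ s ∈ Icc a c, 0 ≤ w s := fun s hs => (hu0 s hs).trans_eq (hwu s hs).symm
  intro s hs
  have hnorm := norm_le_gronwallBound_of_norm_deriv_right_le
    (f := fun s => D + K * ∫ r in a..s, w r) (f' := fun s => K * w s) (δ := D) (K := K) (ε := 0)
    (fun s _ => (hderiv s).continuousAt.continuousWithinAt)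
    (fun s _ => (hderiv s).hasDerivWithinAt) (by simp [abs_of_nonneg hD])
    (fun r hr => by
      have hr' := Ico_subset_Icc_self hr
      rw [Real.norm_of_nonneg (mul_nonneg hK (hw0 r hr')), add_zero]
      exact mul_le_mul_of_nonneg_left ((hle r hr').trans (le_abs_self _)) hK) s hs
  rw [gronwallBound_ε0] at hnorm
  rw [← hwu s hs]
  exact (hle s hs).trans ((le_abs_self _).trans hnorm)

/-- A bounded jointly measurable function is integrable along a continuous curve. -/
theorem intervalIntegrable_comp_of_continuousOn {S F : Type*} [TopologicalSpace S]
    [MeasurableSpace S] [BorelSpace S] [TopologicalSpace.PseudoMetrizableSpace S]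
    [NormedAddCommGroup F] [MeasurableSpace F] [BorelSpace F] [SecondCountableTopology F]
    {g : ℝ → S → F} {X : ℝ → S} {t T C : ℝ} (ht : t ≤ T)
    (hg : Measurable fun p : ℝ × S => g p.1 p.2) (hX : ContinuousOn X (Icc t T))
    (hC : ∀ᵐ s ∂volume.restrict (Icc t T), ∀ y, ‖g s y‖ ≤ C) :
    IntervalIntegrable (fun s => g s (X s)) volume t T := by
  rw [intervalIntegrable_iff_integrableOn_Icc_of_le ht]
  have hmeas : AEMeasurable (fun s => g s (X s)) (volume.restrict (Icc t T)) :=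
    hg.comp_aemeasurable (aemeasurable_id.prodMk (hX.aemeasurable measurableSet_Icc))
  exact Integrable.of_bound hmeas.aestronglyMeasurable C (hC.mono fun s hs => hs _)

/-- Stability of trajectories with respect to the drift. -/
theorem norm_sub_le_of_isTraj {d : ℕ} {T L t : ℝ} {b b' : ℝ → E d → E d} {x : E d}
    {X X' : ℝ → E d} {β : ℝ → ℝ} (ht : t ≤ T) (hL : 0 ≤ L)
    (hX : IsTraj d T b t x X) (hX' : IsTraj d T b' t x X')
    (hb : IntervalIntegrable (fun s => b s (X s)) volume t T)
    (hb' : IntervalIntegrable (fun s => b' s (X' s)) volume t T)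
    (hβ : IntervalIntegrable β volume t T) (hβ0 : ∀ s, 0 ≤ β s)
    (hlip : ∀ᵐ s ∂volume.restrict (Icc t T), ∀ y z, ‖b s y - b s z‖ ≤ L * ‖y - z‖)
    (hsub : ∀ᵐ s ∂volume.restrict (Icc t T), ∀ y, ‖b s y - b' s y‖ ≤ β s) :
    ∀ s ∈ Icc t T, ‖X s - X' s‖ ≤ (∫ r in t..T, β r) * Real.exp (L * (s - t)) := by
  have hu : ContinuousOn (fun s => ‖X s - X' s‖) (Icc t T) := (hX.1.sub hX'.1).norm
  refine le_mul_exp_of_le_add_mul_integral ht hu (fun _ _ => norm_nonneg _)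
    (intervalIntegral.integral_nonneg ht fun s _ => hβ0 s) hL fun s hs => ?_
  have hsubs : uIcc t s ⊆ uIcc t T := by
    rw [uIcc_of_le hs.1, uIcc_of_le ht]; exact Icc_subset_Icc_right hs.2
  have hui : IntervalIntegrable (fun r => ‖X r - X' r‖) volume t s :=
    (hu.mono (Icc_subset_Icc_right hs.2)).intervalIntegrable_of_Icc hs.1
  have hβs := hβ.mono_set hsubs
  calc ‖X s - X' s‖ = ‖∫ r in t..s, (b r (X r) - b' r (X' r))‖ := by
        rw [intervalIntegral.integral_sub (hb.mono_set hsubs) (hb'.mono_set hsubs),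
          hX.2 s hs, hX'.2 s hs, add_sub_add_left_eq_sub]
    _ ≤ ∫ r in t..s, ‖b r (X r) - b' r (X' r)‖ :=
        intervalIntegral.norm_integral_le_integral_norm hs.1
    _ ≤ ∫ r in t..s, (β r + L * ‖X r - X' r‖) := by
        refine intervalIntegral.integral_mono_ae_restrict hs.1
          ((hb.mono_set hsubs).sub (hb'.mono_set hsubs)).norm (hβs.add (hui.const_mul L)) ?_
        refine ae_restrict_of_ae_restrict_of_subset (Icc_subset_Icc_right hs.2) ?_
        filter_upwards [hlip, hsub] with r h1 h2
        calc ‖b r (X r) - b' r (X' r)‖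
            ≤ ‖b r (X r) - b r (X' r)‖ + ‖b r (X' r) - b' r (X' r)‖ :=
              norm_sub_le_norm_sub_add_norm_sub _ _ _
          _ ≤ β r + L * ‖X r - X' r‖ := by linarith [h1 (X r) (X' r), h2 (X' r)]
    _ = (∫ r in t..s, β r) + L * ∫ r in t..s, ‖X r - X' r‖ := by
        rw [intervalIntegral.integral_add hβs (hui.const_mul L),
          intervalIntegral.integral_const_mul]
    _ ≤ (∫ r in t..T, β r) + L * ∫ r in t..s, ‖X r - X' r‖ := by
        gcongr
        exact intervalIntegral.integral_mono_interval le_rfl hs.1 hs.2 (.of_forall hβ0) hβ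

/-- Pathwise stability of the cost with respect to the coefficients. -/
theorem abs_cost_sub_le_of_isTraj {d : ℕ} {T L t γ : ℝ} {b b' : ℝ → E d → E d}
    {f f' : ℝ → E d → ℝ} {G G' : E d → ℝ} {x : E d} {X X' : ℝ → E d} {β φ : ℝ → ℝ}
    (ht : t ∈ Icc 0 T) (hL : 0 ≤ L)
    (hX : IsTraj d T b t x X) (hX' : IsTraj d T b' t x X')
    (hb : IntervalIntegrable (fun s => b s (X s)) volume t T)
    (hb' : IntervalIntegrable (fun s => b' s (X' s)) volume t T)
    (hf : IntervalIntegrable (fun s => f s (X s)) volume t T)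
    (hf' : IntervalIntegrable (fun s => f' s (X' s)) volume t T)
    (hβ : IntervalIntegrable β volume t T) (hφ : IntervalIntegrable φ volume t T)
    (hβ0 : ∀ s, 0 ≤ β s)
    (hblip : ∀ᵐ s ∂volume.restrict (Icc t T), ∀ y z, ‖b s y - b s z‖ ≤ L * ‖y - z‖)
    (hbsub : ∀ᵐ s ∂volume.restrict (Icc t T), ∀ y, ‖b s y - b' s y‖ ≤ β s)
    (hflip : ∀ᵐ s ∂volume.restrict (Icc t T), ∀ y z, |f s y - f s z| ≤ L * ‖y - z‖)
    (hfsub : ∀ᵐ s ∂volume.restrict (Icc t T), ∀ y, |f s y - f' s y| ≤ φ s)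
    (hGlip : ∀ y z, |G y - G z| ≤ L * ‖y - z‖) (hGsub : ∀ y, |G y - G' y| ≤ γ) :
    |((∫ s in t..T, f s (X s)) + G (X T)) - ((∫ s in t..T, f' s (X' s)) + G' (X' T))| ≤
      γ + ∫ s in t..T, (φ s + L * (T + 1) * Real.exp (L * T) * β s) := by
  set D := ∫ r in t..T, β r with hDdef
  have hD : 0 ≤ D := intervalIntegral.integral_nonneg ht.2 fun s _ => hβ0 s
  set M := D * Real.exp (L * T) with hM
  have hM0 : 0 ≤ M := by positivity
  have htraj : ∀ s ∈ Icc t T, ‖X s - X' s‖ ≤ M := fun s hs =>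
    (norm_sub_le_of_isTraj ht.2 hL hX hX' hb hb' hβ hβ0 hblip hbsub s hs).trans <| by
      rw [hM]; gcongr; linarith [hs.2, ht.1]
  have hrun : |(∫ s in t..T, f s (X s)) - ∫ s in t..T, f' s (X' s)| ≤
      (∫ s in t..T, φ s) + (T - t) * (L * M) := by
    rw [← intervalIntegral.integral_sub hf hf']
    calc |∫ s in t..T, (f s (X s) - f' s (X' s))|
        ≤ ∫ s in t..T, |f s (X s) - f' s (X' s)| :=
          intervalIntegral.abs_integral_le_integral_abs ht.2
      _ ≤ ∫ s in t..T, (φ s + L * M) := by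
          refine intervalIntegral.integral_mono_ae_restrict ht.2 (hf.sub hf').abs
            (hφ.add intervalIntegrable_const) ?_
          filter_upwards [hflip, hfsub, ae_restrict_mem measurableSet_Icc] with s h1 h2 hs
          have h3 := mul_le_mul_of_nonneg_left (htraj s hs) hL
          linarith [abs_sub_le (f s (X s)) (f s (X' s)) (f' s (X' s)), h1 (X s) (X' s), h2 (X' s)]
      _ = (∫ s in t..T, φ s) + (T - t) * (L * M) := by
          rw [intervalIntegral.integral_add hφ intervalIntegrable_const,
            intervalIntegral.integral_const, smul_eq_mul]
  have hterm : |G (X T) - G' (X' T)| ≤ γ + L * M := by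
    have h3 := mul_le_mul_of_nonneg_left (htraj T (right_mem_Icc.2 ht.2)) hL
    linarith [abs_sub_le (G (X T)) (G (X' T)) (G' (X' T)), hGlip (X T) (X' T), hGsub (X' T)]
  rw [intervalIntegral.integral_add hφ (hβ.const_mul _), intervalIntegral.integral_const_mul,
    ← hDdef]
  have hMeq : L * (T + 1) * Real.exp (L * T) * D = T * (L * M) + L * M := by rw [hM]; ring
  have htM : 0 ≤ t * (L * M) := mul_nonneg ht.1 (mul_nonneg hL hM0)
  rw [add_sub_add_comm, hMeq]
  linarith [abs_add_le ((∫ s in t..T, f s (X s)) - ∫ s in t..T, f' s (X' s))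
    (G (X T) - G' (X' T))]

/-- The supremum of the distances of two functions bounded by `L` dominates each distance and is
at most `2 * L`. -/
theorem iSup_norm_sub_bounds {S F : Type*} [Nonempty S] [SeminormedAddCommGroup F]
    {g g' : S → F} {L : ℝ} (hg : ∀ y, ‖g y‖ ≤ L) (hg' : ∀ y, ‖g' y‖ ≤ L) :
    (∀ y, ‖g y - g' y‖ ≤ ⨆ z, ‖g z - g' z‖) ∧ ⨆ z, ‖g z - g' z‖ ≤ 2 * L := by
  have h : ∀ y, ‖g y - g' y‖ ≤ 2 * L := fun y =>
    (norm_sub_le _ _).trans (by linarith [hg y, hg' y])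
  exact ⟨fun y => le_ciSup (f := fun z => ‖g z - g' z‖) ⟨2 * L, by rintro _ ⟨z, rfl⟩; exact h z⟩ y,
    ciSup_le h⟩

/-- The integral of a bounded jointly measurable function over a compact time interval is an
integrable random variable. -/
theorem integrable_intervalIntegral_of_bound {Ω : Type*} [MeasurableSpace Ω] {P : Measure Ω}
    [IsFiniteMeasure P] {g : Ω → ℝ → ℝ} {t T C : ℝ} (ht : t ≤ T)
    (hg : Measurable fun p : Ω × ℝ => g p.1 p.2)
    (hC : ∀ᵐ ω ∂P, ∀ᵐ s ∂volume.restrict (Icc t T), |g ω s| ≤ C) :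
    Integrable (fun ω => ∫ s in t..T, g ω s) P := by
  have hmeas : StronglyMeasurable fun ω => ∫ s in t..T, g ω s := by
    simp only [intervalIntegral.integral_of_le ht]
    exact hg.stronglyMeasurable.integral_prod_right'
  refine Integrable.of_bound hmeas.aestronglyMeasurable (C * (T - t)) ?_
  filter_upwards [hC] with ω hω
  rw [← abs_of_nonneg (sub_nonneg.2 ht)]
  refine intervalIntegral.norm_integral_le_of_norm_le_const_ae ?_
  rw [ae_restrict_iff' measurableSet_Icc] at hω
  filter_upwards [hω] with s hs hmem
  rw [uIoc_of_le ht] at hmem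
  exact hs (Ioc_subset_Icc_self hmem)

/-- The random upper bound for the cost difference of two families of random coefficients is
integrable and dominates the cost difference almost surely. -/
theorem integrable_bound_and_ae_abs_cost_sub_le {Ω : Type*} {mΩ : MeasurableSpace Ω} {P : Measure Ω}
    [IsFiniteMeasure P] {d : ℕ} {T L : ℝ} (hT : 0 ≤ T) (hL : 0 ≤ L)
    {b b' : Ω → ℝ → E d → E d} {f f' : Ω → ℝ → E d → ℝ} {G G' : Ω → E d → ℝ}
    (hco : RandomCoeffs Ω P d T L b f G) (hco' : RandomCoeffs Ω P d T L b' f' G')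
    {δβ δf : Ω → ℝ → ℝ} {δG : Ω → ℝ}
    (hδβ : ∀ ω s, δβ ω s = ⨆ x : E d, ‖b ω s x - b' ω s x‖)
    (hδβm : Measurable fun p : Ω × ℝ => δβ p.1 p.2)
    (hδf : ∀ ω s, δf ω s = ⨆ x : E d, |f ω s x - f' ω s x|)
    (hδfm : Measurable fun p : Ω × ℝ => δf p.1 p.2)
    (hδG : ∀ ω, δG ω = ⨆ x : E d, |G ω x - G' ω x|) (hδGm : Measurable δG)
    {t : ℝ} (ht : t ∈ Icc (0 : ℝ) T) {x : E d} {X X' : Ω → ℝ → E d}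
    (hX : ∀ ω, IsTraj d T (b ω) t x (X ω)) (hX' : ∀ ω, IsTraj d T (b' ω) t x (X' ω)) :
    Integrable (fun ω => δG ω +
      ∫ s in t..T, (δf ω s + L * (T + 1) * Real.exp (L * T) * δβ ω s)) P ∧
    ∀ᵐ ω ∂P,
      |((∫ s in t..T, f ω s (X ω s)) + G ω (X ω T)) -
        ((∫ s in t..T, f' ω s (X' ω s)) + G' ω (X' ω T))| ≤
      δG ω + ∫ s in t..T, (δf ω s + L * (T + 1) * Real.exp (L * T) * δβ ω s) := by
  have hTt : Icc t T ⊆ Icc 0 T := Icc_subset_Icc_left ht.1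
  have hβ0 : ∀ ω s, 0 ≤ δβ ω s := fun ω s => by
    rw [hδβ]; exact Real.iSup_nonneg fun _ => norm_nonneg _
  have hφ0 : ∀ ω s, 0 ≤ δf ω s := fun ω s => by
    rw [hδf]; exact Real.iSup_nonneg fun _ => abs_nonneg _
  have hγ0 : ∀ ω, 0 ≤ δG ω := fun ω => by
    rw [hδG]; exact Real.iSup_nonneg fun _ => abs_nonneg _
  obtain ⟨hbm, hfm, -, hae⟩ := hco
  obtain ⟨hbm', hfm', -, hae'⟩ := hco'
  have htime : ∀ᵐ ω ∂P, ∀ᵐ s ∂volume.restrict (Icc t T),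
      ((∀ y, ‖b ω s y - b' ω s y‖ ≤ δβ ω s) ∧ δβ ω s ≤ 2 * L) ∧
      ((∀ y, |f ω s y - f' ω s y| ≤ δf ω s) ∧ δf ω s ≤ 2 * L) := by
    filter_upwards [hae, hae'] with ω h h'
    filter_upwards [ae_restrict_of_ae_restrict_of_subset hTt h.1,
      ae_restrict_of_ae_restrict_of_subset hTt h'.1] with s hs hs'
    rw [hδβ, hδf]
    exact ⟨iSup_norm_sub_bounds hs.1 hs'.1,
      iSup_norm_sub_bounds (g := f ω s) (g' := f' ω s) hs.2.2.1 hs'.2.2.1⟩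
  have hterm : ∀ᵐ ω ∂P, (∀ y, |G ω y - G' ω y| ≤ δG ω) ∧ δG ω ≤ 2 * L := by
    filter_upwards [hae, hae'] with ω h h'
    rw [hδG]
    exact iSup_norm_sub_bounds (g := G ω) (g' := G' ω) h.2.1 h'.2.1
  set K := L * (T + 1) * Real.exp (L * T) with hK
  have hK0 : 0 ≤ K := by positivity
  have hbound : Integrable (fun ω => δG ω + ∫ s in t..T, (δf ω s + K * δβ ω s)) P := by
    refine Integrable.add (Integrable.of_bound hδGm.aestronglyMeasurable (2 * L) ?_)
      (integrable_intervalIntegral_of_bound (C := 2 * L + K * (2 * L)) ht.2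
        (hδfm.add (hδβm.const_mul K)) ?_)
    · filter_upwards [hterm] with ω h
      rw [Real.norm_of_nonneg (hγ0 ω)]; exact h.2
    · filter_upwards [htime] with ω h
      filter_upwards [h] with s hs
      rw [abs_of_nonneg (add_nonneg (hφ0 ω s) (mul_nonneg hK0 (hβ0 ω s)))]
      exact add_le_add hs.2.2 (mul_le_mul_of_nonneg_left hs.1.2 hK0)
  refine ⟨hbound, ?_⟩
  filter_upwards [hae, hae', htime, hterm] with ω h h' hs hg
  have h1 := ae_restrict_of_ae_restrict_of_subset hTt h.1
  have h1' := ae_restrict_of_ae_restrict_of_subset hTt h'.1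
  have hsec : Measurable fun p : ℝ × E d => (ω, p) := measurable_prodMk_left
  have hδint : ∀ {δ : Ω → ℝ → ℝ}, Measurable (fun p : Ω × ℝ => δ p.1 p.2) →
      (∀ s, 0 ≤ δ ω s) → (∀ᵐ s ∂volume.restrict (Icc t T), δ ω s ≤ 2 * L) →
      IntervalIntegrable (δ ω) volume t T := fun {δ} hm h0 hle => by
    rw [intervalIntegrable_iff_integrableOn_Icc_of_le ht.2]
    refine Integrable.of_bound (hm.comp measurable_prodMk_left).aestronglyMeasurable (2 * L) ?_
    filter_upwards [hle] with s hs
    rwa [Real.norm_of_nonneg (h0 s)]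
  exact abs_cost_sub_le_of_isTraj ht hL (hX ω) (hX' ω)
    (intervalIntegrable_comp_of_continuousOn ht.2 (hbm.comp hsec) (hX ω).1
      (h1.mono fun s k => k.1))
    (intervalIntegrable_comp_of_continuousOn ht.2 (hbm'.comp hsec) (hX' ω).1
      (h1'.mono fun s k => k.1))
    (intervalIntegrable_comp_of_continuousOn ht.2 (hfm.comp hsec) (hX ω).1
      (h1.mono fun s k => k.2.2.1))
    (intervalIntegrable_comp_of_continuousOn ht.2 (hfm'.comp hsec) (hX' ω).1
      (h1'.mono fun s k => k.2.2.1))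
    (hδint hδβm (hβ0 ω) (hs.mono fun s k => k.1.2))
    (hδint hδfm (hφ0 ω) (hs.mono fun s k => k.2.2)) (hβ0 ω)
    (h1.mono fun s k => k.2.1) (hs.mono fun s k => k.1.1)
    (h1.mono fun s k => k.2.2.2) (hs.mono fun s k => k.2.1) h.2.2 hg.1

/-- The conditional approximation estimate underlying Lemma 4.2: for two families of
random coefficients with the same constant `L`, with
`δβ(ω,s) = sup_x |b(ω,s,x) − b̂(ω,s,x)|`, `δf(ω,s) = sup_x |f(ω,s,x) − f̂(ω,s,x)|` and
`δG(ω) = sup_x |G(ω,x) − Ĝ(ω,x)|` assumed measurable, the conditional costs satisfy,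
`P`-a.s., `|J(t,x) − Ĵ(t,x)| ≤ E[δG + ∫_t^T (δf(s) + L(T+1)e^{LT} δβ(s)) ds | 𝒢]`. -/
theorem conditional_cost_coefficient_stability
    {Ω : Type*} [m0 : MeasurableSpace Ω] (P : Measure Ω) [IsProbabilityMeasure P]
    (𝒢 : MeasurableSpace Ω) (h𝒢 : 𝒢 ≤ m0)
    (d : ℕ) (hd : 1 ≤ d) (T L : ℝ) (hT : 0 < T) (hL : 0 < L)
    (b b' : Ω → ℝ → E d → E d) (f f' : Ω → ℝ → E d → ℝ) (G G' : Ω → E d → ℝ)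
    (hco : @RandomCoeffs Ω m0 P d T L b f G)
    (hco' : @RandomCoeffs Ω m0 P d T L b' f' G')
    (δβ δf : Ω → ℝ → ℝ) (δG : Ω → ℝ)
    (hδβ : ∀ ω s, δβ ω s = ⨆ x : E d, ‖b ω s x - b' ω s x‖)
    (hδβm : @Measurable (Ω × ℝ) ℝ (@Prod.instMeasurableSpace Ω ℝ m0 _) _
      (fun p : Ω × ℝ => δβ p.1 p.2))
    (hδf : ∀ ω s, δf ω s = ⨆ x : E d, |f ω s x - f' ω s x|)
    (hδfm : @Measurable (Ω × ℝ) ℝ (@Prod.instMeasurableSpace Ω ℝ m0 _) _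
      (fun p : Ω × ℝ => δf p.1 p.2))
    (hδG : ∀ ω, δG ω = ⨆ x : E d, |G ω x - G' ω x|)
    (hδGm : @Measurable Ω ℝ m0 _ δG)
    (t : ℝ) (ht : t ∈ Icc (0 : ℝ) T) (x : E d)
    (X X' : Ω → ℝ → E d)
    (hX : ∀ ω, IsTraj d T (b ω) t x (X ω))
    (hX' : ∀ ω, IsTraj d T (b' ω) t x (X' ω))
    (hXint : Integrable (fun ω => (∫ s in t..T, f ω s (X ω s)) + G ω (X ω T)) P)
    (hX'int : Integrable (fun ω => (∫ s in t..T, f' ω s (X' ω s)) + G' ω (X' ω T)) P) :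
    ∀ᵐ ω ∂P,
      |(P[fun ω' => (∫ s in t..T, f ω' s (X ω' s)) + G ω' (X ω' T)|𝒢]) ω -
        (P[fun ω' => (∫ s in t..T, f' ω' s (X' ω' s)) + G' ω' (X' ω' T)|𝒢]) ω| ≤
      (P[fun ω' => δG ω' +
        ∫ s in t..T, (δf ω' s + L * (T + 1) * Real.exp (L * T) * δβ ω' s)|𝒢]) ω := by
  obtain ⟨hbound, hpath⟩ := integrable_bound_and_ae_abs_cost_sub_le hT.le hL.le hco hco'
    hδβ hδβm hδf hδfm hδG hδGm ht hX hX'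
  filter_upwards [condExp_sub hXint hX'int 𝒢, abs_condExp_ae_le_condExp_abs (m := 𝒢) (μ := P)
    ((fun ω => (∫ s in t..T, f ω s (X ω s)) + G ω (X ω T)) -
      fun ω => (∫ s in t..T, f' ω s (X' ω s)) + G' ω (X' ω T)),
    condExp_mono (m := 𝒢) (hXint.sub hX'int).abs hbound hpath] with ω hsub habs hmono
  rw [Pi.abs_apply, hsub] at habs
  exact habs.trans hmono
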